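/- arXiv:2507.22531 — 3 statements merged into one kernel-verified Lean document; each statement's English description precedes it below -/
import Mathlib

section
/- For every integer n ≥ 2: the element S̄¹ commutes with every element of G_n (it is central in G_n); S̄¹ does not belong to the subgroup A_n; and every element of G_n can be written uniquely in the form a ∘ (S̄¹)^ε with a ∈ A_n and ε ∈ {0,1}. In particular G_n is isomorphic to the direct product A_n × ℤ/2ℤ. -/
open Real Matrix

noncomputable def xiZero : Matrix.orthogonalGroup (Fin 4) ℝ :=
  ⟨!![1,0,0,0; 0,-1,0,0; 0,0,1,0; 0,0,0,-1], by
    rw [Matrix.mem_orthogonalGroup_iff]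
    ext i j
    fin_cases i <;> fin_cases j <;>
      simp [Matrix.mul_apply, Fin.sum_univ_four, Matrix.star_apply, Matrix.one_apply]⟩

noncomputable def XiPlus (n : ℕ) : Matrix.orthogonalGroup (Fin 4) ℝ :=
  ⟨!![Real.cos (π / n), Real.sin (π / n), 0, 0;
      Real.sin (π / n), -Real.cos (π / n), 0, 0;
      0, 0, 1, 0;
      0, 0, 0, 1], by
    rw [Matrix.mem_orthogonalGroup_iff]
    ext i j
    fin_cases i <;> fin_cases j <;>
      simp [Matrix.mul_apply, Fin.sum_univ_four, Matrix.star_apply, Matrix.one_apply] <;>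
      nlinarith [Real.sin_sq_add_cos_sq (π / n)]⟩

noncomputable def SOne : Matrix.orthogonalGroup (Fin 4) ℝ :=
  ⟨!![1,0,0,0; 0,1,0,0; 0,0,-1,0; 0,0,0,-1], by
    rw [Matrix.mem_orthogonalGroup_iff]
    ext i j
    fin_cases i <;> fin_cases j <;>
      simp [Matrix.mul_apply, Fin.sum_univ_four, Matrix.star_apply, Matrix.one_apply]⟩

/-- The antiprismatic group `A_n ≤ O(4)` generated by `ξ̄₀` and `Ξ̄_{1/(2n)}`. -/
noncomputable def Agrp (n : ℕ) : Subgroup (Matrix.orthogonalGroup (Fin 4) ℝ) :=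
  Subgroup.closure {xiZero, XiPlus n}

/-- The group `G_n ≤ O(4)` generated by `ξ̄₀`, `Ξ̄_{1/(2n)}` and `S̄¹`. -/
noncomputable def Ggrp (n : ℕ) : Subgroup (Matrix.orthogonalGroup (Fin 4) ℝ) :=
  Subgroup.closure {xiZero, XiPlus n, SOne}

namespace Subgroup

variable {G : Type*} [Group G] {A : Subgroup G} {s : G}

/-- Multiplication `(a, ε) ↦ a * s ^ ε` as a homomorphism, for an involution `s` centralizing `A`. -/
def mulInvolutionHom (A : Subgroup G) (s : G) (hs : s ^ 2 = 1) (hc : ∀ a ∈ A, Commute s a) :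
    A × Multiplicative (ZMod 2) →* G :=
  MonoidHom.noncommCoprod A.subtype
    (MonoidHom.mk' (fun ε => s ^ (Multiplicative.toAdd ε).val) fun a b => by
      rw [toAdd_mul, ZMod.val_add, ← pow_add, pow_eq_pow_mod (_ + _) hs])
    fun a _ => ((hc a a.2).pow_left _).symm

@[simp]
theorem mulInvolutionHom_apply (hs : s ^ 2 = 1) (hc : ∀ a ∈ A, Commute s a)
    (p : A × Multiplicative (ZMod 2)) :
    mulInvolutionHom A s hs hc p = p.1 * s ^ (Multiplicative.toAdd p.2).val :=
  rfl

theorem mulInvolutionHom_injective (hs : s ^ 2 = 1) (hc : ∀ a ∈ A, Commute s a) (hA : s ∉ A) :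
    Function.Injective (mulInvolutionHom A s hs hc) := by
  rw [injective_iff_map_eq_one]
  rintro ⟨a, ε⟩ h
  obtain ⟨k, rfl⟩ := Multiplicative.ofAdd.surjective ε
  rw [mulInvolutionHom_apply] at h
  fin_cases k
  · have ha : (a : G) = 1 := (mul_one _).symm.trans ((pow_zero s).symm ▸ h)
    exact Prod.ext (Subtype.ext ha) rfl
  · have ha : (a : G) * s = 1 := pow_one s ▸ h
    exact absurd (eq_inv_of_mul_eq_one_right ha ▸ A.inv_mem a.2) hA

theorem range_mulInvolutionHom (hs : s ^ 2 = 1) (hc : ∀ a ∈ A, Commute s a) :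
    (mulInvolutionHom A s hs hc).range = A ⊔ closure {s} := by
  apply le_antisymm
  · rintro _ ⟨p, rfl⟩
    exact mul_mem_sup p.1.2 (_root_.pow_mem (mem_closure_singleton_self s) _)
  · refine sup_le (fun a ha => ⟨(⟨a, ha⟩, 1), by simp⟩) ((closure_le _).2 ?_)
    rintro _ rfl
    exact ⟨(1, Multiplicative.ofAdd 1), by simp [ZMod.val_one]⟩

end Subgroup

theorem SOne_sq : SOne ^ 2 = 1 := by
  ext i j
  fin_cases i <;> fin_cases j <;> simp [SOne, pow_two]

theorem commute_SOne_xiZero : Commute SOne xiZero := by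
  ext i j
  fin_cases i <;> fin_cases j <;> simp [SOne, xiZero]

theorem commute_SOne_XiPlus (n : ℕ) : Commute SOne (XiPlus n) := by
  ext i j
  fin_cases i <;> fin_cases j <;> simp [SOne, XiPlus]

theorem Ggrp_eq_sup (n : ℕ) : Ggrp n = Agrp n ⊔ Subgroup.closure {SOne} := by
  rw [Ggrp, Agrp, ← Subgroup.closure_union]
  rw [Set.insert_union, Set.singleton_union]

theorem commute_SOne_of_mem_Ggrp {n : ℕ} {g : Matrix.orthogonalGroup (Fin 4) ℝ}
    (hg : g ∈ Ggrp n) : Commute SOne g := by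
  have hle : Ggrp n ≤ Subgroup.centralizer {SOne} := by
    refine (Subgroup.closure_le _).2 ?_
    rintro _ (rfl | rfl | rfl) <;> rw [SetLike.mem_coe, Subgroup.mem_centralizer_singleton_iff]
    · exact commute_SOne_xiZero.symm
    · exact (commute_SOne_XiPlus n).symm
  exact (Subgroup.mem_centralizer_singleton_iff.1 (hle hg)).symm

/-- The third coordinate vector is fixed by `Agrp n`. -/
theorem mulVec_single_two_of_mem_Agrp {n : ℕ} {g : Matrix.orthogonalGroup (Fin 4) ℝ}
    (hg : g ∈ Agrp n) : g.1 *ᵥ Pi.single 2 1 = Pi.single 2 1 := by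
  induction hg using Subgroup.closure_induction with
  | mem x hx =>
    rcases hx with rfl | rfl <;> ext i <;> fin_cases i <;> simp [xiZero, XiPlus]
  | one => rw [OneMemClass.coe_one, Matrix.one_mulVec]
  | mul x y _ _ hx hy =>
    rw [Submonoid.coe_mul, ← Matrix.mulVec_mulVec, hy, hx]
  | inv x _ hx =>
    conv_lhs => rw [← hx]
    rw [Matrix.mulVec_mulVec, ← Submonoid.coe_mul, inv_mul_cancel, OneMemClass.coe_one,
      Matrix.one_mulVec]

theorem SOne_notMem_Agrp (n : ℕ) : SOne ∉ Agrp n := by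
  intro h
  have h2 := congrFun (mulVec_single_two_of_mem_Agrp h) 2
  have h1 : (-1 : ℝ) = 1 := by simpa [SOne] using h2
  norm_num at h1

/-- `S̄¹` is central in `G_n`, does not lie in `A_n`, and every element of `G_n` is uniquely
`a ∘ (S̄¹)^ε` with `a ∈ A_n`, `ε ∈ {0,1}`; hence `G_n ≅ A_n × ℤ/2ℤ`. -/
theorem Ggrp_decomposition (n : ℕ) (hn : 2 ≤ n) :
    (∀ g ∈ Ggrp n, SOne * g = g * SOne) ∧
    SOne ∉ Agrp n ∧
    (∀ g ∈ Ggrp n, ∃! p : ↥(Agrp n) × Fin 2,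
      g = (p.1 : Matrix.orthogonalGroup (Fin 4) ℝ) * SOne ^ (p.2 : ℕ)) ∧
    Nonempty (↥(Ggrp n) ≃* ↥(Agrp n) × Multiplicative (ZMod 2)) := by
  have hc : ∀ a ∈ Agrp n, Commute SOne a := fun a ha =>
    commute_SOne_of_mem_Ggrp (Ggrp_eq_sup n ▸ Subgroup.mem_sup_left ha)
  have hinj := Subgroup.mulInvolutionHom_injective SOne_sq hc (SOne_notMem_Agrp n)
  have hrange : (Subgroup.mulInvolutionHom _ _ SOne_sq hc).range = Ggrp n :=
    (Subgroup.range_mulInvolutionHom SOne_sq hc).trans (Ggrp_eq_sup n).symm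
  refine ⟨fun g hg => commute_SOne_of_mem_Ggrp hg, SOne_notMem_Agrp n, fun g hg => ?_,
    ⟨((MonoidHom.ofInjective hinj).trans (MulEquiv.subgroupCongr hrange)).symm⟩⟩
  obtain ⟨p, rfl⟩ := hrange.symm ▸ hg
  exact ⟨p, rfl, fun q hq => (hinj hq).symm⟩
end

section
/- Let n ≥ 2 be an integer and let H be a 3-dimensional linear subspace of ℝ⁴ such that g(H) = H for every element g of the group A_n. Then H = {x ∈ ℝ⁴ : x₄ = 0} or H = {x ∈ ℝ⁴ : x₃ = 0}. (Equivalently: the only A_n-equivariant great spheres in S³ are the equatorial sphere S² = S³ ∩ {x₄ = 0} and the great sphere Z = S³ ∩ {x₃ = 0}, where a great sphere is the intersection of S³ with a 3-dimensional linear subspace and it is A_n-equivariant if each element of A_n maps it onto itself.) -/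
open Real Matrix

/-- A linear map preserving the kernel of a functional `f` rescales `f`, in the form of a
cross-multiplied identity. -/
theorem LinearMap.mul_apply_comm_of_map_ker_le {K V : Type*} [CommRing K] [AddCommGroup V]
    [Module K V] {f : V →ₗ[K] K} {T : V →ₗ[K] V} (h : (ker f).map T ≤ ker f) (v w : V) :
    f v * f (T w) = f w * f (T v) := by
  have hmem : f v • w - f w • v ∈ ker f := by
    simp [mul_comm]
  have hT := h (Submodule.mem_map_of_mem hmem)
  simpa [sub_eq_zero] using hT

/-- A subspace of codimension one is the kernel of a nonzero functional. -/
theorem Submodule.exists_eq_ker_of_finrank_add_one_eq {K V : Type*} [Field K] [AddCommGroup V]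
    [Module K V] [FiniteDimensional K V] {H : Submodule K V}
    (hdim : Module.finrank K H + 1 = Module.finrank K V) :
    ∃ f : V →ₗ[K] K, f ≠ 0 ∧ H = LinearMap.ker f := by
  have hlt : H < ⊤ := by
    rw [lt_top_iff_ne_top]
    rintro rfl
    rw [finrank_top] at hdim
    omega
  obtain ⟨f, hf, hle⟩ := H.exists_le_ker_of_lt_top hlt
  refine ⟨f, hf, eq_of_le_of_finrank_eq hle ?_⟩
  have := Module.Dual.finrank_ker_add_one_of_ne_zero (f := f) hf
  omega

/-- The only `A_n`-invariant 3-dimensional linear subspaces of `ℝ⁴` are `{x₄ = 0}` and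
`{x₃ = 0}`; equivalently, the only `A_n`-equivariant great spheres in `S³` are the
equatorial sphere `S²` and the great sphere `Z`. -/
theorem Agrp_invariant_hyperplanes (n : ℕ) (hn : 2 ≤ n)
    (H : Submodule ℝ (Fin 4 → ℝ)) (hdim : Module.finrank ℝ H = 3)
    (hinv : ∀ g ∈ Agrp n, H.map ((g : Matrix (Fin 4) (Fin 4) ℝ)).mulVecLin = H) :
    H = LinearMap.ker (LinearMap.proj 3 : (Fin 4 → ℝ) →ₗ[ℝ] ℝ) ∨
    H = LinearMap.ker (LinearMap.proj 2 : (Fin 4 → ℝ) →ₗ[ℝ] ℝ) := by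
  obtain ⟨f, hf, rfl⟩ := H.exists_eq_ker_of_finrank_add_one_eq (by simp [hdim])
  have hs : 0 < Real.sin (π / n) := by
    have hn' : (2 : ℝ) ≤ n := by exact_mod_cast hn
    refine Real.sin_pos_of_pos_of_lt_pi (by positivity) (div_lt_self Real.pi_pos (by linarith))
  obtain ⟨a, ha⟩ : ∃ a : Fin 4 → ℝ, ∀ x, f x = a 0 * x 0 + a 1 * x 1 + a 2 * x 2 + a 3 * x 3 :=
    ⟨fun i => f (Pi.single i 1), fun x => by
      conv_lhs => rw [← Finset.univ_sum_single x, map_sum, Fin.sum_univ_four]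
      simp only [← mul_comm (x _), ← smul_eq_mul, ← map_smul, ← Pi.single_smul]
      simp only [smul_eq_mul, mul_one]⟩
  have hxi := LinearMap.mul_apply_comm_of_map_ker_le
    (hinv xiZero (Subgroup.subset_closure (by simp))).le
  have hXi := LinearMap.mul_apply_comm_of_map_ker_le
    (hinv (XiPlus n) (Subgroup.subset_closure (by simp))).le
  have h01 := hxi ![1, 0, 0, 0] ![0, 1, 0, 0]
  have h23 := hxi ![0, 0, 1, 0] ![0, 0, 0, 1]
  have hX := hXi ![1, 0, 0, 0] ![0, 1, 0, 0]
  simp [ha, xiZero, XiPlus] at h01 h23 hX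
  have h01' : a 0 * a 1 = 0 := by linarith
  have h23' : a 2 * a 3 = 0 := by linarith
  have hsq : a 0 ^ 2 = a 1 ^ 2 := by
    apply mul_left_cancel₀ hs.ne'
    linear_combination hX + 2 * Real.cos (π / n) * h01'
  obtain ⟨h0, h1⟩ : a 0 = 0 ∧ a 1 = 0 := by
    rcases mul_eq_zero.mp h01' with h | h
    · exact ⟨h, by simpa [h] using hsq.symm⟩
    · exact ⟨by simpa [h] using hsq, h⟩
  have hne : a 2 ≠ 0 ∨ a 3 ≠ 0 := by
    by_contra! h
    exact hf (LinearMap.ext fun x => by simp [ha, h0, h1, h])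
  rcases mul_eq_zero.mp h23' with h | h
  · left
    ext x
    simp_all
  · right
    ext x
    simp_all
end

section
/- Let n ≥ 2 be an integer and let L be a 1-dimensional linear subspace of ℝ⁴. Then g(L) = L for every element g of the group A_n if and only if L is the span of e₃ = (0,0,1,0) or the span of e₄ = (0,0,0,1). -/
open Real Matrix

/-- A subspace is invariant under a group of orthogonal matrices as soon as it is invariant under
a generating set. -/
theorem map_mulVecLin_eq_of_mem_closure {ι : Type*} [Fintype ι] [DecidableEq ι]
    {S : Set (Matrix.orthogonalGroup ι ℝ)} {L : Submodule ℝ (ι → ℝ)}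
    (hS : ∀ g ∈ S, L.map (g : Matrix ι ι ℝ).mulVecLin = L)
    {g : Matrix.orthogonalGroup ι ℝ} (hg : g ∈ Subgroup.closure S) :
    L.map (g : Matrix ι ι ℝ).mulVecLin = L := by
  induction hg using Subgroup.closure_induction with
  | mem g hg => exact hS g hg
  | one => simp
  | mul g h _ _ hg hh =>
    rw [Submonoid.coe_mul, Matrix.mulVecLin_mul, Submodule.map_comp, hh, hg]
  | inv g _ hg =>
    conv_lhs => rw [← hg]
    rw [← Submodule.map_comp, ← Matrix.mulVecLin_mul, ← Submonoid.coe_mul, inv_mul_cancel]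
    simp

/-- A one-dimensional subspace is spanned by each of its nonzero vectors. -/
theorem Submodule.eq_span_singleton_of_finrank_eq_one {K V : Type*} [Field K] [AddCommGroup V]
    [Module K V] {L : Submodule K V} (hL : Module.finrank K L = 1) {v : V} (hv : v ∈ L)
    (hv0 : v ≠ 0) : L = Submodule.span K {v} := by
  have : FiniteDimensional K L := Module.finite_of_finrank_eq_succ hL
  refine (Submodule.eq_of_le_of_finrank_eq ?_ ?_).symm
  · rwa [Submodule.span_singleton_le_iff_mem]
  · rw [hL, finrank_span_singleton hv0]

theorem xiZero_mulVec (v : Fin 4 → ℝ) :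
    (xiZero : Matrix (Fin 4) (Fin 4) ℝ) *ᵥ v = ![v 0, -v 1, v 2, -v 3] := by
  ext i
  fin_cases i <;> simp [xiZero, Matrix.mulVec, dotProduct, Fin.sum_univ_four]

theorem XiPlus_mulVec (n : ℕ) (v : Fin 4 → ℝ) :
    (XiPlus n : Matrix (Fin 4) (Fin 4) ℝ) *ᵥ v =
      ![Real.cos (π / n) * v 0 + Real.sin (π / n) * v 1,
        Real.sin (π / n) * v 0 - Real.cos (π / n) * v 1, v 2, v 3] := by
  ext i
  fin_cases i <;> simp [XiPlus, Matrix.mulVec, dotProduct, Fin.sum_univ_four, sub_eq_add_neg]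

theorem sin_pi_div_natCast_pos {n : ℕ} (hn : 2 ≤ n) : 0 < Real.sin (π / n) := by
  have hn' : (1 : ℝ) < n := by exact_mod_cast hn
  exact Real.sin_pos_of_pos_of_lt_pi (by positivity) (div_lt_self Real.pi_pos hn')

/-- A common eigenvector of `ξ̄₀` and `Ξ̄_{1/(2n)}` lies on one of the last two coordinate axes. -/
theorem eq_axis_of_eigenvector {n : ℕ} (hn : 2 ≤ n) {v : Fin 4 → ℝ} {c d : ℝ}
    (hc : c • v = (xiZero : Matrix (Fin 4) (Fin 4) ℝ) *ᵥ v)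
    (hd : d • v = (XiPlus n : Matrix (Fin 4) (Fin 4) ℝ) *ᵥ v) :
    v = v 2 • ![0, 0, 1, 0] ∨ v = v 3 • ![0, 0, 0, 1] := by
  rw [xiZero_mulVec] at hc
  rw [XiPlus_mulVec] at hd
  have hs := (sin_pi_div_natCast_pos hn).ne'
  have c0 : c * v 0 = v 0 := congrFun hc 0
  have c1 : c * v 1 = -v 1 := congrFun hc 1
  have c2 : c * v 2 = v 2 := congrFun hc 2
  have c3 : c * v 3 = -v 3 := congrFun hc 3
  have d0 : d * v 0 = Real.cos (π / n) * v 0 + Real.sin (π / n) * v 1 := congrFun hd 0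
  have d1 : d * v 1 = Real.sin (π / n) * v 0 - Real.cos (π / n) * v 1 := congrFun hd 1
  by_cases h : c = 1
  · subst h
    have h1 : v 1 = 0 := by linarith
    have h3 : v 3 = 0 := by linarith
    have h0 : v 0 = 0 := by simpa [h1, hs] using d1
    left
    ext i
    fin_cases i <;> simp [h0, h1, h3]
  · have h0 : v 0 = 0 := by
      by_contra h'
      exact h (mul_right_cancel₀ h' (by linarith))
    have h2 : v 2 = 0 := by
      by_contra h'
      exact h (mul_right_cancel₀ h' (by linarith))
    have h1 : v 1 = 0 := by simpa [h0, hs] using d0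
    right
    ext i
    fin_cases i <;> simp [h0, h1, h2]

/-- A 1-dimensional linear subspace `L` of `ℝ⁴` is invariant under every element of `A_n`
if and only if `L` is the span of `e₃ = (0,0,1,0)` or the span of `e₄ = (0,0,0,1)`. -/
theorem Agrp_invariant_lines (n : ℕ) (hn : 2 ≤ n)
    (L : Submodule ℝ (Fin 4 → ℝ)) (hdim : Module.finrank ℝ L = 1) :
    (∀ g ∈ Agrp n, L.map ((g : Matrix (Fin 4) (Fin 4) ℝ)).mulVecLin = L) ↔
      (L = Submodule.span ℝ {![0, 0, 1, 0]} ∨ L = Submodule.span ℝ {![0, 0, 0, 1]}) := by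
  constructor
  · intro h
    obtain ⟨⟨v, hv⟩, hv0, -⟩ := finrank_eq_one_iff'.mp hdim
    have hv0 : v ≠ 0 := fun h0 => hv0 (Subtype.ext h0)
    have hL := Submodule.eq_span_singleton_of_finrank_eq_one hdim hv hv0
    have eigen (g : Matrix.orthogonalGroup (Fin 4) ℝ) (hg : g ∈ Agrp n) :
        ∃ c : ℝ, c • v = (g : Matrix (Fin 4) (Fin 4) ℝ) *ᵥ v := by
      rw [← Submodule.mem_span_singleton, ← hL]
      have hgv := Submodule.mem_map_of_mem (f := (g : Matrix (Fin 4) (Fin 4) ℝ).mulVecLin) hv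
      rwa [h g hg] at hgv
    obtain ⟨c, hc⟩ := eigen xiZero (Subgroup.subset_closure (by simp))
    obtain ⟨d, hd⟩ := eigen (XiPlus n) (Subgroup.subset_closure (by simp))
    refine (eq_axis_of_eigenvector hn hc hd).imp (fun hva => ?_) (fun hva => ?_) <;>
    · rw [hL, hva]
      refine Submodule.span_singleton_smul_eq (IsUnit.mk0 _ fun h0 => hv0 ?_) _
      rw [hva, h0, zero_smul]
  · intro hL g hg
    refine map_mulVecLin_eq_of_mem_closure (fun g hg => ?_) hg
    rcases hg with rfl | rfl <;> rcases hL with rfl | rfl <;>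
      rw [Submodule.map_span, Set.image_singleton, Matrix.mulVecLin_apply]
    · simp [xiZero_mulVec]
    · rw [xiZero_mulVec, ← Submodule.span_singleton_smul_eq (isUnit_one.neg : IsUnit (-1 : ℝ))]
      simp
    · simp [XiPlus_mulVec]
    · simp [XiPlus_mulVec]
end
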